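/- Let A be an abelian length category and n a positive integer. Then there is a bijective correspondence between the set of decreasing sequences of maximal meet intervals in tors A of length n and the set of ICE sequences in A of length n+1. Explicitly, to a decreasing sequence {[U_k, T_k]}_{k=1}^n one associates the ICE sequence given (after reindexing so that C(0) = A and C(n+1) = 0) by C(k) = T_k ∩ U_{k−1}^⊥ for 1 ≤ k ≤ n, C(k) = A for k ≤ 0 and C(k) = 0 for k ≥ n+1, where U_0 = 0. -/

import Mathlib

open CategoryTheory Limits ZeroObject

namespace ICEPaper

variable {A : Type*} [Category A] [Abelian A]

/-- A full additive subcategory (given by its class of objects), closed under isomorphisms. -/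
structure IsSubcat (C : Set A) : Prop where
  mem_of_iso : ∀ ⦃X Y : A⦄, (X ≅ Y) → X ∈ C → Y ∈ C
  zero_mem : (0 : A) ∈ C
  biprod_mem : ∀ ⦃X Y : A⦄, X ∈ C → Y ∈ C → (X ⊞ Y) ∈ C

/-- `C` is closed under extensions. -/
def ClosedUnderExtensions (C : Set A) : Prop :=
  ∀ (S : ShortComplex A), S.ShortExact → S.X₁ ∈ C → S.X₃ ∈ C → S.X₂ ∈ C

/-- `C` is closed under quotients in `A`. -/
def ClosedUnderQuotients (C : Set A) : Prop :=
  ∀ ⦃X Y : A⦄ (f : X ⟶ Y), Epi f → X ∈ C → Y ∈ C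

/-- `C` is closed under images. -/
def ClosedUnderImages (C : Set A) : Prop :=
  ∀ ⦃X Y : A⦄ (f : X ⟶ Y), X ∈ C → Y ∈ C → image f ∈ C

/-- `C` is closed under cokernels. -/
def ClosedUnderCokernels (C : Set A) : Prop :=
  ∀ ⦃X Y : A⦄ (f : X ⟶ Y), X ∈ C → Y ∈ C → cokernel f ∈ C

/-- `C` is closed under kernels. -/
def ClosedUnderKernels (C : Set A) : Prop :=
  ∀ ⦃X Y : A⦄ (f : X ⟶ Y), X ∈ C → Y ∈ C → kernel f ∈ C

/-- `C` is a torsion class in `A`. -/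
structure IsTorsionClass (C : Set A) : Prop where
  subcat : IsSubcat C
  ext : ClosedUnderExtensions C
  quot : ClosedUnderQuotients C

/-- `C` is a wide subcategory of `A`. -/
structure IsWide (C : Set A) : Prop where
  subcat : IsSubcat C
  ext : ClosedUnderExtensions C
  ker : ClosedUnderKernels C
  coker : ClosedUnderCokernels C

/-- `C` is an ICE-closed subcategory of `A`. -/
structure IsICEClosed (C : Set A) : Prop where
  subcat : IsSubcat C
  im : ClosedUnderImages C
  coker : ClosedUnderCokernels C
  ext : ClosedUnderExtensions C

/-- `αC = {X ∈ C ∣ every morphism f : C' ⟶ X with C' ∈ C has ker f ∈ C}`. -/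
def alphaSub (C : Set A) : Set A :=
  {X | X ∈ C ∧ ∀ ⦃C' : A⦄ (f : C' ⟶ X), C' ∈ C → kernel f ∈ C}

/-- `D` is a torsion class in the full (wide, hence abelian) subcategory `W` of `A`:
`D ⊆ W`, and `D` is closed under extensions and quotients inside `W`.
(Here short exact sequences and epimorphisms in the wide subcategory `W` are
exactly those of `A` with terms in `W`.) -/
structure IsTorsionClassIn (W D : Set A) : Prop where
  subset : D ⊆ W
  subcat : IsSubcat D
  ext : ∀ (S : ShortComplex A), S.ShortExact → S.X₁ ∈ D → S.X₃ ∈ D → S.X₂ ∈ D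
  quot : ∀ ⦃X Y : A⦄ (f : X ⟶ Y), Epi f → X ∈ D → Y ∈ W → Y ∈ D

/-- The exactness condition defining narrow sequences: for every exact sequence
`A → B → C → D → E` with `A ∈ C(k−1)`, `B, D ∈ C(k)` and `E ∈ C(k+1)` one has `C ∈ C(k)`. -/
def NarrowCondition (C : ℤ → Set A) : Prop :=
  ∀ (k : ℤ) (S : ComposableArrows A 4), S.Exact →
    S.obj' 0 ∈ C (k - 1) → S.obj' 1 ∈ C k → S.obj' 3 ∈ C k → S.obj' 4 ∈ C (k + 1) →
    S.obj' 2 ∈ C k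

/-- A narrow sequence in `A`. -/
structure IsNarrowSequence (C : ℤ → Set A) : Prop where
  subcat : ∀ k, IsSubcat (C k)
  decreasing : ∀ k, C (k + 1) ⊆ C k
  narrow : NarrowCondition C

/-- An ICE sequence in `A`. -/
structure IsICESequence (C : ℤ → Set A) : Prop where
  ice : ∀ k, IsICEClosed (C k)
  tors : ∀ k, IsTorsionClassIn (alphaSub (C k)) (C (k + 1))

/-- The zero subcategory. -/
def zeroSubcat : Set A := {X | IsZero X}


/-- `U^⊥ = {X ∣ Hom(C, X) = 0 for all C ∈ U}`. -/
def perpSet (U : Set A) : Set A := {X | ∀ ⦃C : A⦄, C ∈ U → ∀ f : C ⟶ X, f = 0}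

/-- There is an arrow `T → U` in the Hasse quiver of `tors A`: both are torsion classes,
`U ⊊ T`, and no torsion class lies strictly between them. -/
def HasseArrow (T U : Set A) : Prop :=
  IsTorsionClass T ∧ IsTorsionClass U ∧ U ⊂ T ∧
    ¬∃ C : Set A, IsTorsionClass C ∧ U ⊂ C ∧ C ⊂ T

/-- `[U, T]` is a wide interval in `tors A`: `U ⊆ T` are torsion classes and the heart
`T ∩ U^⊥` is a wide subcategory of `A`. -/
def IsWideInterval (U T : Set A) : Prop :=
  IsTorsionClass U ∧ IsTorsionClass T ∧ U ⊆ T ∧ IsWide (T ∩ perpSet U)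

/-- `[U', T']` is a maximal meet interval in the wide interval `[U, T]`:
`U' = T' ∩ ⋂ {C ∈ [U, T] ∣ there is an arrow T' → C in Hasse(tors A)}`. -/
def IsMaxMeetIntervalIn (U T U' T' : Set A) : Prop :=
  IsWideInterval U T ∧ IsTorsionClass U' ∧ IsTorsionClass T' ∧
    U ⊆ U' ∧ U' ⊆ T' ∧ T' ⊆ T ∧
    U' = T' ∩ ⋂₀ {C : Set A | IsTorsionClass C ∧ U ⊆ C ∧ C ⊆ T ∧ HasseArrow T' C}

/-- A decreasing sequence of maximal meet intervals `{[U_k, T_k]}_{k=1}^n` in `tors A`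
(encoded with indices `0, …, n`, where `U_0 = 0` and `T_0 = A`). -/
def IsDecreasingMaxMeetSeq {n : ℕ} (U T : Fin (n + 1) → Set A) : Prop :=
  U 0 = zeroSubcat ∧ T 0 = Set.univ ∧
    ∀ k : Fin n, IsMaxMeetIntervalIn (U k.castSucc) (T k.castSucc) (U k.succ) (T k.succ)

/-! ### Induction principles in a length category -/

/-- All objects have subobject lattices satisfying both chain conditions. -/
def IsLen (A : Type*) [Category A] : Prop :=
  ∀ X : A, WellFoundedGT (Subobject X) ∧ WellFoundedLT (Subobject X)

lemma sub_induction (hl : IsLen A) {P : A → Prop}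
    (h : ∀ X : A, (∀ (Y : A) (i : Y ⟶ X), Mono i → ¬ IsIso i → P Y) → P X) (X : A) : P X := by
  have := (hl X).2
  suffices H : ∀ K : Subobject X, ∀ (Y : A) (i : Y ⟶ X) (_ : Mono i), Subobject.mk i = K → P Y from
    H _ X (𝟙 X) inferInstance rfl
  intro K
  induction K using WellFoundedLT.induction with
  | ind K ih =>
    intro Y i hi hK
    apply h
    intro Z j hj hji
    refine ih (Subobject.mk (j ≫ i)) ?_ Z (j ≫ i) inferInstance rfl
    rw [← hK]
    refine lt_of_le_of_ne (Subobject.mk_le_mk_of_comm j rfl) ?_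
    intro he
    apply hji
    have h1 := Subobject.isoOfMkEqMk _ _ he
    have h2 : Subobject.mk i ≤ Subobject.mk (j ≫ i) := he.ge
    have h3 := Subobject.ofMkLEMk_comp h2
    have h4 : Subobject.ofMkLEMk i (j ≫ i) h2 ≫ j = 𝟙 Y := by
      rw [← cancel_mono i]; simp
    have : IsSplitEpi j := ⟨⟨⟨_, h4⟩⟩⟩
    exact isIso_of_mono_of_isSplitEpi j

lemma quot_induction (hl : IsLen A) {P : A → Prop}
    (h : ∀ X : A, (∀ (Y : A) (q : X ⟶ Y), Epi q → ¬ IsIso q → P Y) → P X) (X : A) : P X := by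
  have := (hl X).1
  suffices H : ∀ K : Subobject X, ∀ (Y : A) (q : X ⟶ Y) (_ : Epi q),
      Subobject.mk (kernel.ι q) = K → P Y from
    H _ X (𝟙 X) inferInstance rfl
  intro K
  induction K using WellFoundedGT.induction with
  | ind K ih =>
    intro Y q hq hK
    apply h
    intro Z r hr hrr
    refine ih (Subobject.mk (kernel.ι (q ≫ r))) ?_ Z (q ≫ r) (epi_comp _ _) rfl
    rw [← hK]
    refine lt_of_le_of_ne (Subobject.mk_le_mk_of_comm
      (kernel.lift _ (kernel.ι q) (by rw [kernel.condition_assoc, zero_comp])) (by simp)) ?_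
    intro he
    apply hrr
    have h2 : Subobject.mk (kernel.ι (q ≫ r)) ≤ Subobject.mk (kernel.ι q) := he.ge
    have h3 : kernel.ι (q ≫ r) ≫ q = 0 := by
      rw [← Subobject.ofMkLEMk_comp h2, Category.assoc, kernel.condition, comp_zero]
    have : Mono r := by
      apply Preadditive.mono_of_cancel_zero
      intro W x hx
      have h4 : pullback.fst q x ≫ q ≫ r = 0 := by
        rw [← Category.assoc, pullback.condition, Category.assoc, hx, comp_zero]
      have h5 : pullback.fst q x ≫ q = 0 := by
        rw [← kernel.lift_ι _ _ h4, Category.assoc, h3, comp_zero]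
      rw [pullback.condition] at h5
      rw [← cancel_epi (pullback.snd q x), h5, comp_zero]
    exact isIso_of_mono_of_epi r

lemma isIso_of_epi_endo (hl : IsLen A) (X : A) : ∀ f : X ⟶ X, Epi f → IsIso f := by
  refine quot_induction hl (P := fun X => ∀ f : X ⟶ X, Epi f → IsIso f) ?_ X
  intro X ih f hf
  by_contra hn
  exact hn (ih X f hf hn f hf)

/-! ### Basic closure lemmas -/

lemma IsSubcat.of_isZero {C : Set A} (h : IsSubcat C) {X : A} (hX : IsZero X) : X ∈ C :=
  h.mem_of_iso hX.isoZero.symm h.zero_mem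

lemma ext_of_epi {C : Set A} (h : ClosedUnderExtensions C) {X Y : A} (f : X ⟶ Y) [Epi f]
    (hk : kernel f ∈ C) (hY : Y ∈ C) : X ∈ C := by
  have hs : (ShortComplex.mk (kernel.ι f) f (kernel.condition f)).ShortExact :=
    { exact := ShortComplex.exact_kernel f }
  exact h _ hs hk hY

lemma ext_of_epi_iff {C : Set A} (hi : ∀ ⦃X Y : A⦄, (X ≅ Y) → X ∈ C → Y ∈ C)
    (h : ∀ ⦃X Y : A⦄ (f : X ⟶ Y), Epi f → kernel f ∈ C → Y ∈ C → X ∈ C) :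
    ClosedUnderExtensions C := by
  intro S hS h1 h3
  have := hS.epi_g
  have := hS.mono_f
  refine h S.g inferInstance (hi ?_ h1) h3
  exact IsLimit.conePointUniqueUpToIso hS.fIsKernel (limit.isLimit _)

lemma biprod_of_ext {C : Set A} (h : ClosedUnderExtensions C) {X Y : A} (hX : X ∈ C) (hY : Y ∈ C) :
    (X ⊞ Y) ∈ C := by
  have hs : (ShortComplex.mk (biprod.inl : X ⟶ X ⊞ Y) biprod.snd (by simp)).ShortExact :=
    (ShortComplex.Splitting.mk biprod.fst biprod.inr (by simp) (by simp) (by simp)).shortExact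
  exact h _ hs hX hY

lemma pullback_mem {C : Set A} (hs : IsSubcat C) (h : ClosedUnderExtensions C) {X Y Z : A}
    (q : X ⟶ Y) [Epi q] (g : Z ⟶ Y) (hk : kernel q ∈ C) (hZ : Z ∈ C) : pullback q g ∈ C := by
  have sq := (IsPullback.of_hasPullback q g).flip
  have := isIso_kernel_map_of_isPullback sq
  exact ext_of_epi h (pullback.snd q g) (hs.mem_of_iso (asIso (kernel.map _ _ _ _ sq.w)).symm hk) hZ

lemma kernelCompIso {X Y Z : A} (q : X ⟶ Y) (f : Y ⟶ Z) :
    Nonempty (pullback q (kernel.ι f) ≅ kernel (q ≫ f)) := by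
  have w1 : pullback.fst q (kernel.ι f) ≫ q ≫ f = 0 := by
    rw [← Category.assoc, pullback.condition, Category.assoc, kernel.condition, comp_zero]
  have w2 : (kernel.ι (q ≫ f) ≫ q) ≫ f = 0 := by rw [Category.assoc, kernel.condition]
  have w3 : kernel.ι (q ≫ f) ≫ q = kernel.lift f _ w2 ≫ kernel.ι f := by simp
  have sq := IsPullback.of_hasPullback q (kernel.ι f)
  refine ⟨⟨kernel.lift _ _ w1, sq.lift (kernel.ι _) _ w3, ?_, ?_⟩⟩
  · apply sq.hom_ext
    · simp
    · rw [← cancel_mono (kernel.ι f)]; simp [pullback.condition]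
  · rw [← cancel_mono (kernel.ι _)]; simp

lemma kernel_comp_mem {C : Set A} (hs : IsSubcat C) (h : ClosedUnderExtensions C) {X Y Z : A}
    (q : X ⟶ Y) [Epi q] (f : Y ⟶ Z) (hk : kernel q ∈ C) (hf : kernel f ∈ C) :
    kernel (q ≫ f) ∈ C :=
  hs.mem_of_iso (kernelCompIso q f).some (pullback_mem hs h q _ hk hf)

lemma kernel_cokernel_mem {C : Set A} (h : ClosedUnderQuotients C) {X Y : A} (f : X ⟶ Y)
    (hX : X ∈ C) : kernel (cokernel.π f) ∈ C :=
  h (Abelian.factorThruImage f) inferInstance hX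

/-! ### Perpendicular categories -/

lemma perp_of_mono {U : Set A} {X Y : A} (i : X ⟶ Y) [Mono i] (hY : Y ∈ perpSet U) :
    X ∈ perpSet U := by
  intro C hC f
  rw [← cancel_mono i, zero_comp]
  exact hY hC _

lemma perp_of_epi {U : Set A} {X Y : A} (f : X ⟶ Y) (hk : kernel f ∈ perpSet U)
    (hY : Y ∈ perpSet U) : X ∈ perpSet U := by
  intro C hC g
  rw [← kernel.lift_ι f g (hY hC _), hk hC (kernel.lift f g (hY hC _)), zero_comp]

lemma perp_zero {U : Set A} {X : A} (hX : IsZero X) : X ∈ perpSet U :=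
  fun _ _ _ => hX.eq_of_tgt _ _

lemma perp_anti {U V : Set A} (h : U ⊆ V) : perpSet V ⊆ perpSet U :=
  fun _ hX _ hC f => hX (h hC) f

lemma perp_ext (U : Set A) : ClosedUnderExtensions (perpSet U) :=
  ext_of_epi_iff (fun _ _ e h => perp_of_mono e.inv h) (fun _ _ f _ hk hY => perp_of_epi f hk hY)

lemma perp_subcat (U : Set A) : IsSubcat (perpSet U) where
  mem_of_iso _ _ e h := perp_of_mono e.inv h
  zero_mem := perp_zero (isZero_zero A)
  biprod_mem _ _ hX hY := biprod_of_ext (perp_ext U) hX hY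

lemma isZero_of_mem_perp {U : Set A} {X : A} (h : X ∈ U) (h' : X ∈ perpSet U) : IsZero X :=
  (IsZero.iff_id_eq_zero X).2 (h' h (𝟙 X))

lemma inter_subcat {C D : Set A} (hC : IsSubcat C) (hD : IsSubcat D) : IsSubcat (C ∩ D) where
  mem_of_iso _ _ e h := ⟨hC.mem_of_iso e h.1, hD.mem_of_iso e h.2⟩
  zero_mem := ⟨hC.zero_mem, hD.zero_mem⟩
  biprod_mem _ _ hX hY := ⟨hC.biprod_mem hX.1 hY.1, hD.biprod_mem hX.2 hY.2⟩

lemma inter_ext {C D : Set A} (hC : ClosedUnderExtensions C) (hD : ClosedUnderExtensions D) :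
    ClosedUnderExtensions (C ∩ D) :=
  fun S hS h1 h3 => ⟨hC S hS h1.1 h3.1, hD S hS h1.2 h3.2⟩

lemma torsion_pair (hl : IsLen A) {U : Set A} (hU : IsTorsionClass U) (X : A) :
    ∃ (Q : A) (q : X ⟶ Q), Epi q ∧ kernel q ∈ U ∧ Q ∈ perpSet U := by
  refine quot_induction hl
    (P := fun X => ∃ (Q : A) (q : X ⟶ Q), Epi q ∧ kernel q ∈ U ∧ Q ∈ perpSet U) ?_ X
  intro X ih
  by_cases hX : X ∈ perpSet U
  · exact ⟨X, 𝟙 X, inferInstance, hU.subcat.of_isZero (isZero_kernel_of_mono _), hX⟩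
  · simp only [perpSet, Set.mem_ofPred_eq, not_forall] at hX
    obtain ⟨C, hC, g, hg⟩ := hX
    obtain ⟨Q, q, hq, hk, hQ⟩ := ih _ (cokernel.π g) inferInstance (cokernel_not_iso_of_nonzero hg)
    exact ⟨Q, cokernel.π g ≫ q, epi_comp _ _,
      kernel_comp_mem hU.subcat hU.ext _ _ (kernel_cokernel_mem hU.quot g hC) hk, hQ⟩

/-! ### The operation `α` -/

lemma alpha_of_mono {C : Set A} (hs : IsSubcat C) {X M : A} (i : X ⟶ M) [Mono i] (hX : X ∈ C)
    (hM : M ∈ alphaSub C) : X ∈ alphaSub C :=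
  ⟨hX, fun _ f hf => hs.mem_of_iso (kernelCompMono f i) (hM.2 (f ≫ i) hf)⟩

lemma alpha_of_isZero {C : Set A} (hs : IsSubcat C) {X : A} (hX : IsZero X) : X ∈ alphaSub C := by
  refine ⟨hs.of_isZero hX, fun C' f hf => ?_⟩
  obtain rfl : f = 0 := hX.eq_of_tgt _ _
  exact hs.mem_of_iso kernelZeroIsoSource.symm hf

lemma alpha_ext {C : Set A} (hs : IsSubcat C) (h : ClosedUnderExtensions C) {M N : A}
    (g : M ⟶ N) [Epi g] (hk : kernel g ∈ alphaSub C) (hN : N ∈ alphaSub C) : M ∈ alphaSub C := by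
  refine ⟨ext_of_epi h g hk.1 hN.1, fun C' f hf => ?_⟩
  have h1 := hN.2 (f ≫ g) hf
  let l : kernel (f ≫ g) ⟶ kernel g := kernel.lift g (kernel.ι (f ≫ g) ≫ f) (by simp)
  have hl : l ≫ kernel.ι g = kernel.ι (f ≫ g) ≫ f := kernel.lift_ι _ _ _
  have h2 : kernel l ∈ C := hk.2 l h1
  let e : kernel l ≅ kernel f :=
    { hom := kernel.lift f (kernel.ι l ≫ kernel.ι (f ≫ g)) (by
        rw [Category.assoc, ← hl, kernel.condition_assoc, zero_comp])
      inv := kernel.lift l (kernel.lift (f ≫ g) (kernel.ι f) (by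
        rw [kernel.condition_assoc, zero_comp])) (by
        rw [← cancel_mono (kernel.ι g), Category.assoc, hl]; simp)
      hom_inv_id := by
        rw [← cancel_mono (kernel.ι l), ← cancel_mono (kernel.ι (f ≫ g))]; simp
      inv_hom_id := by
        rw [← cancel_mono (kernel.ι f)]; simp }
  exact hs.mem_of_iso e h2

lemma alpha_of_epi {C : Set A} (hs : IsSubcat C) (h : ClosedUnderExtensions C) {M Q : A}
    (p : M ⟶ Q) [Epi p] (hk : kernel p ∈ C) (hQ : Q ∈ C) (hM : M ∈ alphaSub C) :
    Q ∈ alphaSub C := by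
  refine ⟨hQ, fun C' f hf => ?_⟩
  have h1 := hM.2 (pullback.fst p f) (pullback_mem hs h p f hk hf)
  have sq := IsPullback.of_hasPullback p f
  have := isIso_kernel_map_of_isPullback sq
  exact hs.mem_of_iso (asIso (kernel.map _ _ _ _ sq.w)) h1

lemma kernel_cokernel_mem' {C : Set A} (hC : IsICEClosed C) {X Y : A} (f : X ⟶ Y)
    (hX : X ∈ C) (hY : Y ∈ C) : kernel (cokernel.π f) ∈ C :=
  hC.subcat.mem_of_iso (Abelian.imageIsoImage f).symm (hC.im f hX hY)

lemma alpha_wide {C : Set A} (hC : IsICEClosed C) : IsWide (alphaSub C) := by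
  have hi : ∀ ⦃X Y : A⦄, (X ≅ Y) → X ∈ alphaSub C → Y ∈ alphaSub C := fun X Y e h =>
    alpha_of_mono hC.subcat e.inv (hC.subcat.mem_of_iso e h.1) h
  have hext : ClosedUnderExtensions (alphaSub C) :=
    ext_of_epi_iff hi (fun X Y f _ hk hY => alpha_ext hC.subcat hC.ext f hk hY)
  refine ⟨⟨hi, alpha_of_isZero hC.subcat (isZero_zero A), fun X Y hX hY => biprod_of_ext hext hX hY⟩,
    hext, ?_, ?_⟩
  · intro X Y f hX hY
    exact alpha_of_mono hC.subcat (kernel.ι f) (hY.2 f hX.1) hX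
  · intro X Y f hX hY
    exact alpha_of_epi hC.subcat hC.ext (cokernel.π f) (kernel_cokernel_mem' hC f hX.1 hY.1)
      (hC.coker f hX.1 hY.1) hY

/-! ### The main theorem on maximal meet intervals -/

section Main

variable {U T T' : Set A}

lemma ice_of_interval (hw : IsWide (T ∩ perpSet U)) (hT' : IsTorsionClass T')
    (h2 : T' ⊆ T) : IsICEClosed (T' ∩ perpSet U) where
  subcat := inter_subcat hT'.subcat (perp_subcat U)
  ext := inter_ext hT'.ext (perp_ext U)
  im X Y f hX hY := ⟨hT'.quot (factorThruImage f) inferInstance hX.1,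
    perp_of_mono (image.ι f) hY.2⟩
  coker X Y f hX hY := ⟨hT'.quot (cokernel.π f) inferInstance hY.1,
    (hw.coker f ⟨h2 hX.1, hX.2⟩ ⟨h2 hY.1, hY.2⟩).2⟩

/-- Kernels of maps from the torsion class to objects of its alpha are again in it. -/
lemma kernel_mem_of_alpha (hl : IsLen A) (hU : IsTorsionClass U) (hT' : IsTorsionClass T')
    (h1 : U ⊆ T') {S : A} (hS : S ∈ alphaSub (T' ∩ perpSet U)) {Y : A} (hY : Y ∈ T')
    (f : Y ⟶ S) : kernel f ∈ T' := by
  obtain ⟨Q, q, hq, hk, hQ⟩ := torsion_pair hl hU Y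
  have h0 : kernel.ι q ≫ f = 0 := hS.1.2 hk _
  have hf : q ≫ Abelian.epiDesc q f h0 = f := Abelian.comp_epiDesc q f h0
  rw [← hf]
  exact kernel_comp_mem hT'.subcat hT'.ext q _ (h1 hk)
    (hS.2 (Abelian.epiDesc q f h0) ⟨hT'.quot q hq hY, hQ⟩).1

lemma image_mem_alpha (hT' : IsTorsionClass T')
    {S : A} (hS : S ∈ alphaSub (T' ∩ perpSet U)) {Y : A} (hY : Y ∈ T')
    (f : Y ⟶ S) : kernel (cokernel.π f) ∈ alphaSub (T' ∩ perpSet U) :=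
  alpha_of_mono (inter_subcat hT'.subcat (perp_subcat U)) (kernel.ι (cokernel.π f))
    ⟨kernel_cokernel_mem hT'.quot f hY, perp_of_mono (kernel.ι (cokernel.π f)) hS.1.2⟩ hS

lemma exists_simple_quot (hl : IsLen A) (hw : IsWide (T ∩ perpSet U)) 
    (hT' : IsTorsionClass T') (h2 : T' ⊆ T) (N : A) :
    N ∈ alphaSub (T' ∩ perpSet U) → ¬ IsZero N →
    ∃ (S : A) (p : N ⟶ S), Epi p ∧ S ∈ alphaSub (T' ∩ perpSet U) ∧ ¬ IsZero S ∧
      ∀ ⦃Y : A⦄ (g : Y ⟶ S), Y ∈ T' → g ≠ 0 → Epi g := by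
  have hice := ice_of_interval hw hT' h2
  refine quot_induction hl (P := fun N => N ∈ alphaSub (T' ∩ perpSet U) → ¬ IsZero N →
    ∃ (S : A) (p : N ⟶ S), Epi p ∧ S ∈ alphaSub (T' ∩ perpSet U) ∧ ¬ IsZero S ∧
      ∀ ⦃Y : A⦄ (g : Y ⟶ S), Y ∈ T' → g ≠ 0 → Epi g) ?_ N
  intro N ih hN h0
  by_cases hs : ∀ ⦃Y : A⦄ (g : Y ⟶ N), Y ∈ T' → g ≠ 0 → Epi g
  · exact ⟨N, 𝟙 N, inferInstance, hN, h0, hs⟩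
  · push Not at hs
    obtain ⟨Y, g, hY, hg, hge⟩ := hs
    have hI := image_mem_alpha hT' hN hY g
    have hQC : cokernel g ∈ T' ∩ perpSet U := by
      have h := hice.coker (kernel.ι (cokernel.π g)) hI.1 hN.1
      have e : cokernel (kernel.ι (cokernel.π g)) ≅ cokernel g :=
        IsColimit.coconePointUniqueUpToIso (colimit.isColimit _)
          (Abelian.epiIsCokernelOfKernel _ (limit.isLimit (parallelPair (cokernel.π g) 0)))
      exact hice.subcat.mem_of_iso e h
    have hQ : cokernel g ∈ alphaSub (T' ∩ perpSet U) :=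
      alpha_of_epi hice.subcat hice.ext (cokernel.π g) hI.1 hQC hN
    have hQ0 : ¬ IsZero (cokernel g) := fun hz =>
      hge (Abelian.epi_of_cokernel_π_eq_zero g (hz.eq_of_tgt _ _))
    obtain ⟨S, p, hp, hS⟩ := ih _ (cokernel.π g) inferInstance
      (cokernel_not_iso_of_nonzero hg) hQ hQ0
    exact ⟨S, cokernel.π g ≫ p, epi_comp _ _, hS⟩

/-- Objects of the class without nonzero maps to the given object. -/
def leftPerp (T' : Set A) (S : A) : Set A := {X | X ∈ T' ∧ ∀ f : X ⟶ S, f = 0}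

lemma leftPerp_tors (hT' : IsTorsionClass T') (S : A) : IsTorsionClass (leftPerp T' S) := by
  have hi : ∀ ⦃X Y : A⦄, (X ≅ Y) → X ∈ leftPerp T' S → Y ∈ leftPerp T' S := fun X Y e h =>
    ⟨hT'.subcat.mem_of_iso e h.1, fun f => by rw [← cancel_epi e.hom, comp_zero]; exact h.2 _⟩
  have hext : ClosedUnderExtensions (leftPerp T' S) := by
    refine ext_of_epi_iff hi (fun X Y f hf hk hY => ⟨ext_of_epi hT'.ext f hk.1 hY.1, fun g => ?_⟩)
    have h0 : kernel.ι f ≫ g = 0 := hk.2 _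
    rw [← Abelian.comp_epiDesc f g h0, hY.2 (Abelian.epiDesc f g h0), comp_zero]
  exact ⟨⟨hi, ⟨hT'.subcat.zero_mem, fun f => (isZero_zero A).eq_of_src _ _⟩,
    fun X Y hX hY => biprod_of_ext hext hX hY⟩, hext, fun X Y f hf hX =>
      ⟨hT'.quot f hf hX.1, fun g => by rw [← cancel_epi f, comp_zero]; exact hX.2 _⟩⟩

lemma leftPerp_hasse (hl : IsLen A) (hU : IsTorsionClass U)
    (hT' : IsTorsionClass T') (h1 : U ⊆ T') {S : A} (hS : S ∈ alphaSub (T' ∩ perpSet U))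
    (h0 : ¬ IsZero S) (hs : ∀ ⦃Y : A⦄ (g : Y ⟶ S), Y ∈ T' → g ≠ 0 → Epi g) :
    HasseArrow T' (leftPerp T' S) := by
  have hsub : leftPerp T' S ⊆ T' := fun X hX => hX.1
  refine ⟨hT', leftPerp_tors hT' S, ⟨hsub, fun h => ?_⟩, ?_⟩
  · exact h0 ((IsZero.iff_id_eq_zero S).2 ((h hS.1.1).2 (𝟙 S)))
  · rintro ⟨E, hE, ⟨hDE, hED⟩, ⟨hET, hTE⟩⟩
    apply hTE
    obtain ⟨Y, hYE, hY⟩ := Set.not_subset.1 hED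
    have hY' : ∃ g : Y ⟶ S, g ≠ 0 := by
      by_contra hn
      push Not at hn
      exact hY ⟨hET hYE, hn⟩
    obtain ⟨g, hg⟩ := hY'
    have hSE : S ∈ E := hE.quot g (hs g (hET hYE) hg) hYE
    intro Z
    refine sub_induction hl (P := fun Z => Z ∈ T' → Z ∈ E) ?_ Z
    intro Z ih hZ
    by_cases hZD : ∀ f : Z ⟶ S, f = 0
    · exact hDE ⟨hZ, hZD⟩
    · push Not at hZD
      obtain ⟨f, hf⟩ := hZD
      have := hs f hZ hf
      exact ext_of_epi hE.ext f (ih _ (kernel.ι f) inferInstance (kernel_not_iso_of_nonzero hf)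
        (kernel_mem_of_alpha hl hU hT' h1 hS hZ f)) hSE

lemma mem_of_hasse {D : Set A} (hD : HasseArrow T' D) {Y : A} (hY : Y ∈ T') (h0 : ¬ IsZero Y)
    (hYD : Y ∈ perpSet D) {X : A} (hX : X ∈ T') (hXY : ∀ f : X ⟶ Y, f = 0) : X ∈ D := by
  obtain ⟨hT', hDt, hDT, hn⟩ := hD
  by_contra hXD
  refine hn ⟨leftPerp T' Y, leftPerp_tors hT' Y, ⟨fun Z hZ => ⟨hDT.1 hZ, fun f => hYD hZ f⟩,
    fun h => hXD (h ⟨hX, hXY⟩)⟩, ⟨fun Z hZ => hZ.1, fun h => ?_⟩⟩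
  exact h0 ((IsZero.iff_id_eq_zero Y).2 ((h hY).2 (𝟙 Y)))

lemma exists_minimal_sub (hl : IsLen A) (hT' : IsTorsionClass T') (X : A) :
    X ∈ T' → ¬ IsZero X →
    ∃ (S : A) (i : S ⟶ X), Mono i ∧ S ∈ T' ∧ ¬ IsZero S ∧
      ∀ ⦃Y : A⦄ (g : Y ⟶ S), Y ∈ T' → g ≠ 0 → Epi g := by
  refine sub_induction hl (P := fun X => X ∈ T' → ¬ IsZero X →
    ∃ (S : A) (i : S ⟶ X), Mono i ∧ S ∈ T' ∧ ¬ IsZero S ∧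
      ∀ ⦃Y : A⦄ (g : Y ⟶ S), Y ∈ T' → g ≠ 0 → Epi g) ?_ X
  intro X ih hX h0
  by_cases hs : ∀ ⦃Y : A⦄ (g : Y ⟶ X), Y ∈ T' → g ≠ 0 → Epi g
  · exact ⟨X, 𝟙 X, inferInstance, hX, h0, hs⟩
  · push Not at hs
    obtain ⟨Y, g, hY, hg, hge⟩ := hs
    have hfac : Abelian.factorThruImage g ≫ kernel.ι (cokernel.π g) = g := Abelian.image.fac g
    have hn : ¬ IsIso (kernel.ι (cokernel.π g)) := by
      intro hiso
      apply hge
      rw [← hfac]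
      exact epi_comp _ _
    have hz : ¬ IsZero (kernel (cokernel.π g)) := by
      intro hz
      apply hg
      rw [← hfac, hz.eq_of_src (kernel.ι (cokernel.π g)) 0, comp_zero]
    obtain ⟨S, i, hi, hS⟩ := ih _ (kernel.ι (cokernel.π g)) inferInstance hn
      (kernel_cokernel_mem hT'.quot g hY) hz
    exact ⟨S, i ≫ kernel.ι (cokernel.π g), mono_comp _ _, hS⟩

lemma kernel_mem_of_hasse (hl : IsLen A) {D : Set A} (hD : HasseArrow T' D) {S : A} (hS : S ∈ T')
    (h0 : ¬ IsZero S) (hSD : S ∈ perpSet D)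
    (hs : ∀ ⦃Y : A⦄ (g : Y ⟶ S), Y ∈ T' → g ≠ 0 → Epi g) (Y : A) :
    Y ∈ T' → ∀ f : Y ⟶ S, kernel f ∈ T' := by
  have hT' := hD.1
  refine quot_induction hl (P := fun Y => Y ∈ T' → ∀ f : Y ⟶ S, kernel f ∈ T') ?_ Y
  intro Y ih hY f
  by_cases hf : f = 0
  · subst hf
    exact hT'.subcat.mem_of_iso kernelZeroIsoSource.symm hY
  by_cases hF : kernel f ∈ perpSet T'
  · have hY0 : ¬ IsZero Y := fun hz => hf (hz.eq_of_src _ _)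
    have hYD : Y ∈ perpSet D := by
      intro C hC g
      have hgf : g ≫ f = 0 := hSD hC _
      rw [← kernel.lift_ι f g hgf, hF (hD.2.2.1.1 hC) (kernel.lift f g hgf), zero_comp]
    have hh : ∃ h : S ⟶ Y, h ≠ 0 := by
      by_contra hn
      push Not at hn
      have hSD' := mem_of_hasse hD hY hY0 hYD hS hn
      exact h0 (isZero_of_mem_perp hSD' hSD)
    obtain ⟨h, hh⟩ := hh
    have hhf : h ≫ f ≠ 0 := by
      intro hz
      apply hh
      rw [← kernel.lift_ι f h hz, hF hS (kernel.lift f h hz), zero_comp]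
    have hiso := isIso_of_epi_endo hl S (h ≫ f) (hs _ hS hhf)
    let r : Y ⟶ Y := 𝟙 Y - f ≫ inv (h ≫ f) ≫ h
    have hr : r ≫ f = 0 := by
      simp only [r, Preadditive.sub_comp, Category.assoc, Category.id_comp]
      rw [IsIso.inv_hom_id, Category.comp_id, sub_self]
    have hr0 : r = 0 := by
      rw [← kernel.lift_ι f r hr, hF hY (kernel.lift f r hr), zero_comp]
    have hι : kernel.ι f = 0 := by
      have h5 : kernel.ι f ≫ r = kernel.ι f := by
        simp only [r, Preadditive.comp_sub, Category.comp_id]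
        rw [kernel.condition_assoc, zero_comp, sub_zero]
      rw [← h5, hr0, comp_zero]
    have := Abelian.mono_of_kernel_ι_eq_zero f hι
    exact hT'.subcat.of_isZero (isZero_kernel_of_mono f)
  · simp only [perpSet, Set.mem_ofPred_eq, not_forall] at hF
    obtain ⟨C, hC, g, hg⟩ := hF
    have hg' : g ≫ kernel.ι f ≠ 0 := by
      intro hz
      apply hg
      rw [← cancel_mono (kernel.ι f), hz, zero_comp]
    have hw : (g ≫ kernel.ι f) ≫ f = 0 := by rw [Category.assoc, kernel.condition, comp_zero]
    have h6 := ih _ (cokernel.π (g ≫ kernel.ι f)) inferInstance (cokernel_not_iso_of_nonzero hg')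
      (hT'.quot (cokernel.π (g ≫ kernel.ι f)) inferInstance hY) (cokernel.desc _ f hw)
    have h7 := kernel_comp_mem hT'.subcat hT'.ext (cokernel.π (g ≫ kernel.ι f)) _
      (kernel_cokernel_mem hT'.quot _ hC) h6
    rwa [cokernel.π_desc] at h7

/-- The meet of a torsion class with all its lower covers lying in the interval. -/
def meetOf (U T T' : Set A) : Set A :=
  T' ∩ ⋂₀ {C : Set A | IsTorsionClass C ∧ U ⊆ C ∧ C ⊆ T ∧ HasseArrow T' C}

lemma mem_meetOf_iff (hl : IsLen A) (hU : IsTorsionClass U) (hw : IsWide (T ∩ perpSet U))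
    (hT' : IsTorsionClass T') (h1 : U ⊆ T') (h2 : T' ⊆ T) (X : A) :
    X ∈ meetOf U T T' ↔ X ∈ T' ∧ ∀ M ∈ alphaSub (T' ∩ perpSet U), ∀ f : X ⟶ M, f = 0 := by
  constructor
  · rintro ⟨hX, hXm⟩
    refine ⟨hX, fun M hM f => ?_⟩
    by_contra hf
    have hfac : Abelian.factorThruImage f ≫ kernel.ι (cokernel.π f) = f := Abelian.image.fac f
    have hz : ¬ IsZero (kernel (cokernel.π f)) := by
      intro hz
      apply hf
      rw [← hfac, hz.eq_of_src (kernel.ι (cokernel.π f)) 0, comp_zero]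
    obtain ⟨S, p, hp, hS, hS0, hs⟩ := exists_simple_quot hl hw hT' h2 _
      (image_mem_alpha hT' hM hX f) hz
    have hD := leftPerp_hasse hl hU hT' h1 hS hS0 hs
    have hXD : X ∈ leftPerp T' S := hXm _ ⟨hD.2.1, fun Z hZ => ⟨h1 hZ, fun g => hS.1.2 hZ g⟩,
      fun Z hZ => h2 hZ.1, hD⟩
    have h3 : Abelian.factorThruImage f ≫ p = 0 := hXD.2 (Abelian.factorThruImage f ≫ p)
    have h4 : p = 0 := by
      rw [← cancel_epi (Abelian.factorThruImage f), h3, comp_zero]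
    apply hS0
    rw [IsZero.iff_id_eq_zero, ← cancel_epi p, h4, zero_comp, zero_comp]
  · rintro ⟨hX, hXW⟩
    refine ⟨hX, ?_⟩
    rintro D ⟨hDt, hUD, hDT, hD⟩
    by_contra hXD
    obtain ⟨Q, q, hq, hk, hQ⟩ := torsion_pair hl hDt X
    have hQ0 : ¬ IsZero Q := fun hz =>
      hXD (ext_of_epi hDt.ext q hk (hDt.subcat.of_isZero hz))
    obtain ⟨S, i, hi, hS, hS0, hs⟩ := exists_minimal_sub hl hT' Q (hT'.quot q hq hX) hQ0
    have hSD : S ∈ perpSet D := perp_of_mono i hQ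
    have hSW : S ∈ alphaSub (T' ∩ perpSet U) := by
      refine ⟨⟨hS, perp_anti hUD hSD⟩, fun C f hC => ⟨?_, perp_of_mono (kernel.ι f) hC.2⟩⟩
      exact kernel_mem_of_hasse hl hD hS hS0 hSD hs C hC.1 f
    exact hXD (mem_of_hasse hD hS hS0 hSD hX (hXW S hSW))

lemma heart_meetOf (hl : IsLen A) (hU : IsTorsionClass U) (hw : IsWide (T ∩ perpSet U))
    (hT' : IsTorsionClass T') (h1 : U ⊆ T') (h2 : T' ⊆ T) :
    T' ∩ perpSet (meetOf U T T') = alphaSub (T' ∩ perpSet U) := by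
  have hice := ice_of_interval hw hT' h2
  have hmem := mem_meetOf_iff hl hU hw hT' h1 h2
  have hUm : U ⊆ meetOf U T T' := fun X hX =>
    (hmem X).2 ⟨h1 hX, fun M hM f => hM.1.2 hX f⟩
  apply Set.Subset.antisymm
  · intro X
    refine sub_induction hl (P := fun X => X ∈ T' ∩ perpSet (meetOf U T T') →
      X ∈ alphaSub (T' ∩ perpSet U)) ?_ X
    rintro X ih ⟨hX, hXp⟩
    by_cases hX0 : IsZero X
    · exact alpha_of_isZero hice.subcat hX0
    have hXm : X ∉ meetOf U T T' := fun h => hX0 (isZero_of_mem_perp h hXp)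
    rw [hmem] at hXm
    push Not at hXm
    obtain ⟨M, hM, f, hf⟩ := hXm hX
    have hI := image_mem_alpha hT' hM hX f
    have hfac : Abelian.factorThruImage f ≫ kernel.ι (cokernel.π f) = f := Abelian.image.fac f
    have hf' : Abelian.factorThruImage f ≠ 0 := by
      intro hz
      apply hf
      rw [← hfac, hz, zero_comp]
    have hk := kernel_mem_of_alpha hl hU hT' h1 hI hX (Abelian.factorThruImage f)
    exact alpha_ext hice.subcat hice.ext (Abelian.factorThruImage f)
      (ih _ (kernel.ι _) inferInstance (kernel_not_iso_of_nonzero hf')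
        ⟨hk, perp_of_mono (kernel.ι (Abelian.factorThruImage f)) hXp⟩) hI
  · intro X hX
    exact ⟨hX.1.1, fun C hC f => ((hmem C).1 hC).2 X hX f⟩

lemma meetOf_tors (hT' : IsTorsionClass T') : IsTorsionClass (meetOf U T T') where
  subcat :=
    { mem_of_iso := fun X Y e h => ⟨hT'.subcat.mem_of_iso e h.1, fun C hC =>
        hC.1.subcat.mem_of_iso e (h.2 C hC)⟩
      zero_mem := ⟨hT'.subcat.zero_mem, fun C hC => hC.1.subcat.zero_mem⟩
      biprod_mem := fun X Y hX hY => ⟨hT'.subcat.biprod_mem hX.1 hY.1, fun C hC =>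
        hC.1.subcat.biprod_mem (hX.2 C hC) (hY.2 C hC)⟩ }
  ext S hS h1 h3 := ⟨hT'.ext S hS h1.1 h3.1, fun C hC => hC.1.ext S hS (h1.2 C hC) (h3.2 C hC)⟩
  quot X Y f hf hX := ⟨hT'.quot f hf hX.1, fun C hC => hC.1.quot f hf (hX.2 C hC)⟩

lemma isMaxMeet_meetOf (hw : IsWideInterval U T)
    (hT' : IsTorsionClass T') (h1 : U ⊆ T') (h2 : T' ⊆ T) :
    IsMaxMeetIntervalIn U T (meetOf U T T') T' :=
  ⟨hw, meetOf_tors hT', hT', fun _ hX => ⟨h1 hX, fun _ hC => hC.2.1 hX⟩, fun _ hX => hX.1, h2, rfl⟩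

lemma wideInterval_of_maxMeet (hl : IsLen A) {U' : Set A} (h : IsMaxMeetIntervalIn U T U' T') :
    IsWideInterval U' T' ∧ T' ∩ perpSet U' = alphaSub (T' ∩ perpSet U) ∧
      IsICEClosed (T' ∩ perpSet U) := by
  obtain ⟨⟨hU, hT, hUT, hw⟩, hU', hT', h1, h2, h3, he⟩ := h
  have hh := heart_meetOf hl hU hw hT' (h1.trans h2) h3
  have hm : U' = meetOf U T T' := he
  rw [← hm] at hh
  have hice := ice_of_interval hw hT' h3
  refine ⟨⟨hU', hT', h2, ?_⟩, hh, hice⟩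
  rw [hh]
  exact alpha_wide hice

/-- the torsion class of `A` in `[U, T]` attached to a torsion class `D` of the heart. -/
def torsOf (U T D : Set A) : Set A :=
  {X | X ∈ T ∧ ∀ ⦃Y : A⦄ (f : X ⟶ Y), Epi f → Y ∈ perpSet U → Y ∈ D}

lemma torsOf_spec (hw : IsWideInterval U T) {D : Set A}
    (hD : IsTorsionClassIn (T ∩ perpSet U) D) :
    IsTorsionClass (torsOf U T D) ∧ U ⊆ torsOf U T D ∧ torsOf U T D ⊆ T ∧
      torsOf U T D ∩ perpSet U = D := by
  obtain ⟨hU, hT, hUT, hW⟩ := hw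
  have hq : ClosedUnderQuotients (torsOf U T D) := fun X Y f hf hX =>
    ⟨hT.quot f hf hX.1, fun Z g hg hZ => hX.2 (f ≫ g) (epi_comp _ _) hZ⟩
  have hext : ClosedUnderExtensions (torsOf U T D) := by
    refine ext_of_epi_iff (fun X Y e h => hq e.hom inferInstance h) ?_
    intro X Z f hf hk hZ
    have hXT := ext_of_epi hT.ext f hk.1 hZ.1
    refine ⟨hXT, fun Y g hg hY => ?_⟩
    have hYH : Y ∈ T ∩ perpSet U := ⟨hT.quot g hg hXT, hY⟩
    have hI : kernel (cokernel.π (kernel.ι f ≫ g)) ∈ D :=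
      hk.2 (Abelian.factorThruImage (kernel.ι f ≫ g)) inferInstance
        (perp_of_mono (kernel.ι (cokernel.π (kernel.ι f ≫ g))) hY)
    have hQ : cokernel (kernel.ι f ≫ g) ∈ T ∩ perpSet U := by
      have h := hW.coker (kernel.ι (cokernel.π (kernel.ι f ≫ g))) (hD.subset hI) hYH
      have e : cokernel (kernel.ι (cokernel.π (kernel.ι f ≫ g))) ≅ cokernel (kernel.ι f ≫ g) :=
        IsColimit.coconePointUniqueUpToIso (colimit.isColimit _)
          (Abelian.epiIsCokernelOfKernel _
            (limit.isLimit (parallelPair (cokernel.π (kernel.ι f ≫ g)) 0)))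
      exact hW.subcat.mem_of_iso e h
    have hw0 : kernel.ι f ≫ g ≫ cokernel.π (kernel.ι f ≫ g) = 0 := by
      rw [← Category.assoc, cokernel.condition]
    have hd := Abelian.comp_epiDesc f _ hw0
    have hepi : Epi (Abelian.epiDesc f _ hw0) := by
      have : Epi (f ≫ Abelian.epiDesc f _ hw0) := by rw [hd]; exact epi_comp _ _
      exact epi_of_epi f _
    have hQD := hZ.2 (Abelian.epiDesc f _ hw0) hepi hQ.2
    exact ext_of_epi hD.ext (cokernel.π (kernel.ι f ≫ g)) hI hQD
  have hUs : U ⊆ torsOf U T D := fun X hX => ⟨hUT hX, fun Y f hf hY =>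
    hD.subcat.of_isZero (isZero_of_mem_perp (hU.quot f hf hX) hY)⟩
  refine ⟨⟨⟨fun X Y e h => hq e.hom inferInstance h, hUs hU.subcat.zero_mem,
    fun X Y hX hY => biprod_of_ext hext hX hY⟩, hext, hq⟩, hUs, fun X hX => hX.1, ?_⟩
  apply Set.Subset.antisymm
  · rintro X ⟨hX, hXp⟩
    exact hX.2 (𝟙 X) inferInstance hXp
  · intro X hX
    have hXH := hD.subset hX
    exact ⟨⟨hXH.1, fun Y f hf hY => hD.quot f hf hX ⟨hT.quot f hf hXH.1, hY⟩⟩, hXH.2⟩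

lemma subset_of_heart_eq (hl : IsLen A) (hU : IsTorsionClass U) {T₁ T₂ : Set A}
    (h₁ : IsTorsionClass T₁) (h₂ : IsTorsionClass T₂) (hU₂ : U ⊆ T₂)
    (h : T₁ ∩ perpSet U = T₂ ∩ perpSet U) : T₁ ⊆ T₂ := by
  intro X hX
  obtain ⟨Q, q, hq, hk, hQ⟩ := torsion_pair hl hU X
  have hQ2 : Q ∈ T₂ ∩ perpSet U := h ▸ ⟨h₁.quot q hq hX, hQ⟩
  exact ext_of_epi h₂.ext q (hU₂ hk) hQ2.1

end Main

/-! ### Sequences -/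

lemma zero_subcat : IsSubcat (zeroSubcat : Set A) where
  mem_of_iso _ _ e h := IsZero.of_iso h e.symm
  zero_mem := isZero_zero A
  biprod_mem _ _ hX hY := (biprod_isZero_iff _ _).2 ⟨hX, hY⟩

lemma zero_ext : ClosedUnderExtensions (zeroSubcat : Set A) := by
  intro S hS h1 h3
  exact hS.exact.isZero_of_both_zeros (IsZero.eq_of_src h1 _ _) (IsZero.eq_of_tgt h3 _ _)

lemma zero_quot : ClosedUnderQuotients (zeroSubcat : Set A) :=
  fun _ _ f _ hX => IsZero.of_epi f hX

lemma zero_tors : IsTorsionClass (zeroSubcat : Set A) := ⟨zero_subcat, zero_ext, zero_quot⟩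

lemma zero_ice : IsICEClosed (zeroSubcat : Set A) where
  subcat := zero_subcat
  im _ _ f hX _ := zero_quot (factorThruImage f) inferInstance hX
  coker _ _ f _ hY := zero_quot (cokernel.π f) inferInstance hY
  ext := zero_ext

lemma zero_torsIn {C : Set A} (hC : IsSubcat C) : IsTorsionClassIn (alphaSub C) zeroSubcat where
  subset _ hX := alpha_of_isZero hC hX
  subcat := zero_subcat
  ext := zero_ext
  quot _ _ f _ hX _ := IsZero.of_epi f hX

lemma univ_subcat : IsSubcat (Set.univ : Set A) :=
  ⟨fun _ _ _ _ => trivial, trivial, fun _ _ _ _ => trivial⟩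

lemma univ_tors : IsTorsionClass (Set.univ : Set A) :=
  ⟨univ_subcat, fun _ _ _ _ => trivial, fun _ _ _ _ _ => trivial⟩

lemma univ_ice : IsICEClosed (Set.univ : Set A) :=
  ⟨univ_subcat, fun _ _ _ _ _ => trivial, fun _ _ _ _ _ => trivial, fun _ _ _ _ => trivial⟩

lemma alpha_univ : alphaSub (Set.univ : Set A) = Set.univ :=
  Set.eq_univ_of_forall fun _ => ⟨trivial, fun _ _ _ => trivial⟩

lemma perp_zeroSubcat : perpSet (zeroSubcat : Set A) = Set.univ :=
  Set.eq_univ_of_forall fun _ _ hC _ => IsZero.eq_of_src hC _ _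

lemma wideInterval_zero_univ : IsWideInterval (zeroSubcat : Set A) Set.univ := by
  refine ⟨zero_tors, univ_tors, fun _ _ => trivial, ?_⟩
  rw [perp_zeroSubcat, Set.inter_univ, ← alpha_univ]
  exact alpha_wide univ_ice

lemma torsIn_of_interval {U T T' : Set A} (hT' : IsTorsionClass T') (h : T' ⊆ T) :
    IsTorsionClassIn (T ∩ perpSet U) (T' ∩ perpSet U) where
  subset _ hX := ⟨h hX.1, hX.2⟩
  subcat := inter_subcat hT'.subcat (perp_subcat U)
  ext := inter_ext hT'.ext (perp_ext U)
  quot _ _ f hf hX hY := ⟨hT'.quot f hf hX.1, hY.2⟩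

/-- The ICE sequence of a decreasing sequence, indexed from `0`. -/
noncomputable def iceN {n : ℕ} (U T : Fin (n + 1) → Set A) : ℕ → Set A
  | 0 => Set.univ
  | k + 1 => if h : k < n then
      T ⟨k + 1, by omega⟩ ∩ perpSet (U ⟨k, by omega⟩) else zeroSubcat

section Seq

variable {n : ℕ} {U T : Fin (n + 1) → Set A}

lemma iceN_succ (k : ℕ) (h : k < n) :
    iceN U T (k + 1) = T ⟨k + 1, by omega⟩ ∩ perpSet (U ⟨k, by omega⟩) := dif_pos h

lemma iceN_succ' (k : ℕ) (h : ¬ k < n) : iceN U T (k + 1) = zeroSubcat := dif_neg h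

lemma dec_inv (hl : IsLen A) (hs : IsDecreasingMaxMeetSeq U T) (k : ℕ) : ∀ (hk : k < n + 1),
    IsWideInterval (U ⟨k, hk⟩) (T ⟨k, hk⟩) ∧
      T ⟨k, hk⟩ ∩ perpSet (U ⟨k, hk⟩) = alphaSub (iceN U T k) ∧ IsICEClosed (iceN U T k) := by
  cases k with
  | zero =>
    intro hk
    have h0 : U ⟨0, hk⟩ = zeroSubcat := hs.1
    have h1 : T ⟨0, hk⟩ = Set.univ := hs.2.1
    rw [h0, h1]
    refine ⟨wideInterval_zero_univ, ?_, univ_ice⟩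
    rw [perp_zeroSubcat, Set.inter_univ]
    exact alpha_univ.symm
  | succ k =>
    intro hk
    have h := wideInterval_of_maxMeet hl (hs.2.2 ⟨k, by omega⟩)
    rw [iceN_succ k (by omega)]
    exact h

lemma dec_ice (hl : IsLen A) (hs : IsDecreasingMaxMeetSeq U T) (k : ℕ) :
    IsICEClosed (iceN U T k) := by
  by_cases hk : k < n + 1
  · exact (dec_inv hl hs k hk).2.2
  · obtain ⟨m, rfl⟩ : ∃ m, k = m + 1 := ⟨k - 1, by omega⟩
    rw [iceN_succ' m (by omega)]
    exact zero_ice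

lemma dec_tors (hl : IsLen A) (hs : IsDecreasingMaxMeetSeq U T) (k : ℕ) :
    IsTorsionClassIn (alphaSub (iceN U T k)) (iceN U T (k + 1)) := by
  by_cases hk : k < n
  · rw [iceN_succ k hk, ← (dec_inv hl hs k (by omega)).2.1]
    have h := hs.2.2 ⟨k, hk⟩
    exact torsIn_of_interval h.2.2.1 h.2.2.2.2.2.1
  · rw [iceN_succ' k hk]
    exact zero_torsIn (dec_ice hl hs k).subcat

lemma dec_iceSeq (hl : IsLen A) (hs : IsDecreasingMaxMeetSeq U T) :
    IsICESequence (fun j : ℤ => iceN U T (j + n).toNat) := by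
  refine ⟨fun j => dec_ice hl hs _, fun j => ?_⟩
  by_cases hj : 0 ≤ j + n
  · have : (j + 1 + n).toNat = (j + n).toNat + 1 := by omega
    simp only [this]
    exact dec_tors hl hs _
  · have h1 : (j + 1 + n).toNat = 0 := by omega
    have h2 : (j + n).toNat = 0 := by omega
    simp only [h1, h2, iceN, alpha_univ]
    exact ⟨fun _ _ => trivial, univ_subcat, fun _ _ _ _ => trivial, fun _ _ _ _ _ _ => trivial⟩

lemma dec_inj (hl : IsLen A) {U' T' : Fin (n + 1) → Set A} (hs : IsDecreasingMaxMeetSeq U T)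
    (hs' : IsDecreasingMaxMeetSeq U' T') (h : ∀ k, iceN U T k = iceN U' T' k) (k : ℕ) :
    ∀ hk : k < n + 1, U ⟨k, hk⟩ = U' ⟨k, hk⟩ ∧ T ⟨k, hk⟩ = T' ⟨k, hk⟩ := by
  induction k with
  | zero => exact fun hk => ⟨hs.1.trans hs'.1.symm, hs.2.1.trans hs'.2.1.symm⟩
  | succ k ih =>
    intro hk
    obtain ⟨hU, hT⟩ := ih (by omega)
    have hkn : k < n := by omega
    have h1 := hs.2.2 ⟨k, hkn⟩
    have h2 := hs'.2.2 ⟨k, hkn⟩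
    simp only [Fin.castSucc_mk, Fin.succ_mk] at h1 h2
    rw [← hU, ← hT] at h2
    have he := h (k + 1)
    rw [iceN_succ k hkn, iceN_succ k hkn, ← hU] at he
    obtain ⟨hw, a1, a2, a3, a4, a5, a6⟩ := h1
    obtain ⟨-, b1, b2, b3, b4, b5, b6⟩ := h2
    have hTT : T ⟨k + 1, hk⟩ = T' ⟨k + 1, hk⟩ := Set.Subset.antisymm
      (subset_of_heart_eq hl hw.1 a2 b2 (b3.trans b4) he)
      (subset_of_heart_eq hl hw.1 b2 a2 (a3.trans a4) he.symm)
    refine ⟨?_, hTT⟩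
    rw [a6, b6, hTT]

end Seq

/-- The decreasing sequence attached to an ICE sequence (indexed from `0`). -/
def revSeq (C : ℕ → Set A) : ℕ → Set A × Set A
  | 0 => (zeroSubcat, Set.univ)
  | k + 1 =>
    (meetOf (revSeq C k).1 (revSeq C k).2 (torsOf (revSeq C k).1 (revSeq C k).2 (C (k + 1))),
      torsOf (revSeq C k).1 (revSeq C k).2 (C (k + 1)))

lemma revSeq_step {C : ℕ → Set A} (ht : ∀ k, IsTorsionClassIn (alphaSub (C k)) (C (k + 1))) (k : ℕ)
    (hw : IsWideInterval (revSeq C k).1 (revSeq C k).2)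
    (he : (revSeq C k).2 ∩ perpSet (revSeq C k).1 = alphaSub (C k)) :
    IsMaxMeetIntervalIn (revSeq C k).1 (revSeq C k).2 (revSeq C (k + 1)).1 (revSeq C (k + 1)).2 ∧
      (revSeq C (k + 1)).2 ∩ perpSet (revSeq C k).1 = C (k + 1) := by
  have h := torsOf_spec hw (D := C (k + 1)) (by rw [he]; exact ht k)
  exact ⟨isMaxMeet_meetOf hw h.1 h.2.1 h.2.2.1, h.2.2.2⟩

lemma revSeq_inv (hl : IsLen A) {C : ℕ → Set A} (h0 : C 0 = Set.univ)
    (ht : ∀ k, IsTorsionClassIn (alphaSub (C k)) (C (k + 1))) (k : ℕ) :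
    IsWideInterval (revSeq C k).1 (revSeq C k).2 ∧
      (revSeq C k).2 ∩ perpSet (revSeq C k).1 = alphaSub (C k) := by
  induction k with
  | zero =>
    refine ⟨wideInterval_zero_univ, ?_⟩
    rw [h0, alpha_univ]
    simp only [revSeq]
    rw [perp_zeroSubcat, Set.inter_univ]
  | succ k ih =>
    obtain ⟨h1, h2⟩ := revSeq_step ht k ih.1 ih.2
    have h3 := wideInterval_of_maxMeet hl h1
    rw [h2] at h3
    exact ⟨h3.1, h3.2.1⟩

lemma dec_surj (hl : IsLen A) (n : ℕ) {C : ℤ → Set A} (hC : IsICESequence C)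
    (h1 : C 1 = zeroSubcat) (h2 : C (-(n : ℤ)) = Set.univ) :
    ∃ U T : Fin (n + 1) → Set A, IsDecreasingMaxMeetSeq U T ∧
      (fun j : ℤ => iceN U T (j + n).toNat) = C := by
  let D : ℕ → Set A := fun k => C ((k : ℤ) - n)
  have hD0 : D 0 = Set.univ := by simpa [D] using h2
  have ht : ∀ k, IsTorsionClassIn (alphaSub (D k)) (D (k + 1)) := by
    intro k
    have h := hC.tors ((k : ℤ) - n)
    have e : ((k + 1 : ℕ) : ℤ) - n = (k : ℤ) - n + 1 := by push_cast; ring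
    simp only [D, e]
    exact h
  have hinv := revSeq_inv hl hD0 ht
  have hdec : ∀ j : ℤ, C (j + 1) ⊆ C j := fun j X hX => ((hC.tors j).subset hX).1
  have hanti : Antitone C := antitone_int_of_succ_le hdec
  refine ⟨fun k => (revSeq D k).1, fun k => (revSeq D k).2, ⟨rfl, rfl, fun k => ?_⟩, ?_⟩
  · exact (revSeq_step ht k (hinv k).1 (hinv k).2).1
  · funext j
    by_cases hj : j + n ≤ 0
    · have e : (j + n).toNat = 0 := by omega
      simp only [e, iceN]
      refine (Set.eq_univ_of_univ_subset ?_).symm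
      rw [← h2]
      exact hanti (by omega)
    · obtain ⟨m, hm⟩ : ∃ m : ℕ, j + n = m + 1 := ⟨(j + n - 1).toNat, by omega⟩
      have e : (j + n).toNat = m + 1 := by omega
      simp only [e]
      by_cases hmn : m < n
      · rw [iceN_succ m hmn]
        refine (revSeq_step ht m (hinv m).1 (hinv m).2).2.trans ?_
        simp only [D]
        congr 1
        push_cast
        omega
      · rw [iceN_succ' m hmn]
        apply Set.Subset.antisymm
        · exact fun X hX => (hC.ice j).subcat.of_isZero hX
        · rw [← h1]
          exact hanti (by omega)

/-- **Theorem.** Let `A` be an abelian length category and `n` a positive integer. Then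
decreasing sequences of maximal meet intervals in `tors A` of length `n` are in bijection with
ICE sequences in `A` of length `n+1` (i.e. with `C(1) = 0` and `C(-n) = A`); explicitly,
after reindexing, the sequence `{[U_k, T_k]}_{k=1}^n` corresponds to the ICE sequence with
value `T_k ∩ U_{k-1}^⊥` in the appropriate degree. -/
theorem decreasingMaxMeetSeq_equiv_iceSequences
    {A : Type*} [Category A] [Abelian A]
    (hlength : ∀ X : A, WellFoundedGT (Subobject X) ∧ WellFoundedLT (Subobject X))
    (n : ℕ) (hn : 0 < n) :
    ∃ e : {s : (Fin (n + 1) → Set A) × (Fin (n + 1) → Set A) //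
            IsDecreasingMaxMeetSeq s.1 s.2} ≃
        {C : ℤ → Set A // IsICESequence C ∧ C 1 = zeroSubcat ∧ C (-(n : ℤ)) = Set.univ},
      ∀ s, ∀ i : Fin n,
        (e s).1 (((i : ℕ) : ℤ) + 1 - (n : ℤ)) =
          s.1.2 i.succ ∩ perpSet (s.1.1 i.castSucc) := by
  have hl : IsLen A := hlength
  let φ : {s : (Fin (n + 1) → Set A) × (Fin (n + 1) → Set A) //
            IsDecreasingMaxMeetSeq s.1 s.2} →
        {C : ℤ → Set A // IsICESequence C ∧ C 1 = zeroSubcat ∧ C (-(n : ℤ)) = Set.univ} :=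
    fun s => ⟨fun j : ℤ => iceN s.1.1 s.1.2 (j + n).toNat, dec_iceSeq hl s.2, by
      have e : ((1 : ℤ) + n).toNat = n + 1 := by omega
      simp only [e]
      exact iceN_succ' n (by omega), by
      have e : (-(n : ℤ) + n).toNat = 0 := by omega
      simp only [e]
      rfl⟩
  have hφ : Function.Bijective φ := by
    constructor
    · rintro ⟨⟨U, T⟩, hs⟩ ⟨⟨U', T'⟩, hs'⟩ h
      have h1 : (fun j : ℤ => iceN U T (j + n).toNat) = fun j : ℤ => iceN U' T' (j + n).toNat :=
        congrArg Subtype.val h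
      have h2 : ∀ k, iceN U T k = iceN U' T' k := by
        intro k
        have h3 := congrFun h1 ((k : ℤ) - n)
        have e : ((k : ℤ) - n + n).toNat = k := by omega
        simpa only [e] using h3
      have h4 := dec_inj hl hs hs' h2
      have hU : U = U' := funext fun k => (h4 k k.2).1
      have hT : T = T' := funext fun k => (h4 k k.2).2
      subst hU hT
      rfl
    · rintro ⟨C, hC, h1, h2⟩
      obtain ⟨U, T, hs, he⟩ := dec_surj hl n hC h1 h2
      exact ⟨⟨(U, T), hs⟩, Subtype.ext he⟩
  refine ⟨Equiv.ofBijective φ hφ, fun s i => ?_⟩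
  have e : (((i : ℕ) : ℤ) + 1 - (n : ℤ) + n).toNat = i + 1 := by omega
  change iceN s.1.1 s.1.2 (((i : ℕ) : ℤ) + 1 - (n : ℤ) + n).toNat = _
  rw [e, iceN_succ (i : ℕ) i.2]
  rfl

end ICEPaper
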